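/- Fix integers n ≥ 3 and d ≥ 1, and let A be a union of n pairwise disjoint twistor fibers all meeting a common bidegree (1,0) curve L. Then h¹(I_A(1,d)) ≥ n − 2 + max{0, n − (d+1)}. -/

import Mathlib

open scoped BigOperators

noncomputable section

/-- A bidegree `(1,d)` bihomogeneous polynomial on `ℂ³ × ℂ³` is encoded by a triple
`g : Fin 3 → MvPolynomial (Fin 3) ℂ` of degree-`d` homogeneous polynomials in the
`ℓ`-variables, representing `f(p,ℓ) = ∑ i, p i * g i (ℓ)`.  `evalSection p ℓ` is the
(linear) evaluation of such a section at the point `(p,ℓ)`. -/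
def evalSection (p ℓ : Fin 3 → ℂ) :
    (Fin 3 → MvPolynomial (Fin 3) ℂ) →ₗ[ℂ] ℂ :=
  ∑ i : Fin 3, p i • ((MvPolynomial.aeval ℓ).toLinearMap ∘ₗ LinearMap.proj i)

/-- The twistor fiber `L_{q,q̄} ⊂ F`, at the level of nonzero homogeneous coordinates:
pairs `(p,ℓ)` with `p·ℓ = 0`, `p·q̄ = 0` and `q·ℓ = 0`. -/
def twistorFiberV (q : Fin 3 → ℂ) : Set ((Fin 3 → ℂ) × (Fin 3 → ℂ)) :=
  {x | x.1 ≠ 0 ∧ x.2 ≠ 0 ∧ (∑ i, x.1 i * x.2 i = 0) ∧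
    (∑ i, x.1 i * starRingEnd ℂ (q i) = 0) ∧ (∑ i, q i * x.2 i = 0)}

/-- The space of bidegree `(1,d)` bihomogeneous polynomials vanishing on the union `A` of
the twistor fibers `L_{q k, conj (q k)}`.  Its dimension equals
`h⁰(I_A(1,d)) + h⁰(O_{ℙ²×ℙ²}(0,d-1))`, since the polynomials vanishing on `A` modulo the
multiples of the bidegree `(1,1)` equation of `F` are exactly the sections of
`I_{A,F}(1,d)`. -/
def vanishingOnFibers (d : ℕ) {n : ℕ} (q : Fin n → Fin 3 → ℂ) :
    Submodule ℂ (Fin 3 → MvPolynomial (Fin 3) ℂ) :=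
  (Submodule.pi Set.univ fun _ => MvPolynomial.homogeneousSubmodule (Fin 3) ℂ d) ⊓
    ⨅ (k : Fin n), ⨅ (p : Fin 3 → ℂ), ⨅ (ℓ : Fin 3 → ℂ),
      ⨅ (_ : (p, ℓ) ∈ twistorFiberV (q k)), LinearMap.ker (evalSection p ℓ)

/-! ### Linear algebra of `ℂ³` -/

/-- Cross product in coordinates. -/
def crossV (x y : Fin 3 → ℂ) : Fin 3 → ℂ :=
  ![x 1 * y 2 - x 2 * y 1, x 2 * y 0 - x 0 * y 2, x 0 * y 1 - x 1 * y 0]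

lemma exists_ne_of_ne_zero3 {x : Fin 3 → ℂ} (hx : x ≠ 0) : x 0 ≠ 0 ∨ x 1 ≠ 0 ∨ x 2 ≠ 0 := by
  by_contra! h
  apply hx
  ext i
  fin_cases i <;> simp [h]

lemma parallel_of_cross {x z : Fin 3 → ℂ} (hx : x ≠ 0)
    (h0 : x 1 * z 2 = x 2 * z 1) (h1 : x 2 * z 0 = x 0 * z 2) (h2 : x 0 * z 1 = x 1 * z 0) :
    ∃ c : ℂ, z = c • x := by
  rcases exists_ne_of_ne_zero3 hx with h | h | h
  · refine ⟨z 0 / x 0, ?_⟩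
    ext i
    fin_cases i <;> simp <;> field_simp <;> grind
  · refine ⟨z 1 / x 1, ?_⟩
    ext i
    fin_cases i <;> simp <;> field_simp <;> grind
  · refine ⟨z 2 / x 2, ?_⟩
    ext i
    fin_cases i <;> simp <;> field_simp <;> grind

lemma cross_parallel {q x y : Fin 3 → ℂ} (hq : q ≠ 0) (hx : ∑ i, q i * x i = 0)
    (hy : ∑ i, q i * y i = 0) : ∃ c : ℂ, crossV x y = c • q := by
  rw [Fin.sum_univ_three] at hx hy
  apply parallel_of_cross hq
  · simp [crossV]
    linear_combination x 0 * hy - y 0 * hx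
  · simp [crossV]
    linear_combination x 1 * hy - y 1 * hx
  · simp [crossV]
    linear_combination x 2 * hy - y 2 * hx

lemma orth_span {x : Fin 3 → ℂ} (hx : x ≠ 0) :
    ∃ v w : Fin 3 → ℂ, ∀ y : Fin 3 → ℂ, ∑ i, x i * y i = 0 → ∃ s t : ℂ, y = s • v + t • w := by
  rcases exists_ne_of_ne_zero3 hx with h | h | h
  · refine ⟨![-x 1, x 0, 0], ![-x 2, 0, x 0], fun y hy => ⟨y 1 / x 0, y 2 / x 0, ?_⟩⟩
    rw [Fin.sum_univ_three] at hy
    ext i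
    fin_cases i <;> simp <;> field_simp <;> grind
  · refine ⟨![x 1, -x 0, 0], ![0, -x 2, x 1], fun y hy => ⟨y 0 / x 1, y 2 / x 1, ?_⟩⟩
    rw [Fin.sum_univ_three] at hy
    ext i
    fin_cases i <;> simp <;> field_simp <;> grind
  · refine ⟨![x 2, 0, -x 0], ![0, x 2, -x 1], fun y hy => ⟨y 0 / x 2, y 1 / x 2, ?_⟩⟩
    rw [Fin.sum_univ_three] at hy
    ext i
    fin_cases i <;> simp <;> field_simp <;> grind

/-- Coordinatewise complex conjugation. -/
def conjV (x : Fin 3 → ℂ) : Fin 3 → ℂ := fun i => starRingEnd ℂ (x i)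

/-- The (bilinear) product of `x` with its conjugate. -/
def normV (x : Fin 3 → ℂ) : ℂ := ∑ i, x i * conjV x i

lemma normV_ne_zero {x : Fin 3 → ℂ} (hx : x ≠ 0) : normV x ≠ 0 := by
  intro h
  apply hx
  have h' : ((∑ i, Complex.normSq (x i) : ℝ) : ℂ) = 0 := by
    rw [← h]
    simp [normV, conjV, Complex.mul_conj]
  have h2 : (∑ i, Complex.normSq (x i) : ℝ) = 0 := by exact_mod_cast h'
  rw [Finset.sum_eq_zero_iff_of_nonneg (fun i _ => Complex.normSq_nonneg _)] at h2
  ext i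
  simpa using h2 i (Finset.mem_univ i)

/-- Parametrization of a twistor fiber meeting `L`. -/
lemma fiber_param {q l0 p l : Fin 3 → ℂ} (hq : q ≠ 0) (hl0 : l0 ≠ 0)
    (hql : ∑ i, q i * l0 i = 0) (h : (p, l) ∈ twistorFiberV q) :
    ∃ c s t : ℂ, l = s • l0 + t • crossV (conjV l0) q ∧
      p = c • (s • crossV (conjV q) l0 + t • (normV q • conjV l0)) := by
  obtain ⟨hp, hl, hpl, hpq, hqlx⟩ := h
  simp only at hp hl hpl hpq hqlx
  have hN := normV_ne_zero hl0
  have hQ := normV_ne_zero hq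
  have hconj : ∑ i, conjV q i * conjV l0 i = 0 := by
    have := congrArg (starRingEnd ℂ) hql
    simpa [conjV] using this
  obtain ⟨a, ha⟩ := cross_parallel hq hqlx hql
  have hcr : crossV (conjV q) l ≠ 0 := by
    intro h0
    have hcq : conjV q ≠ 0 := by
      intro h1
      apply hQ
      simp [normV, h1]
    obtain ⟨b, hb⟩ : ∃ b : ℂ, l = b • conjV q := by
      apply parallel_of_cross hcq
      · have := congrFun h0 0
        simp [crossV] at this
        linear_combination this
      · have := congrFun h0 1
        simp [crossV] at this
        linear_combination this
      · have := congrFun h0 2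
        simp [crossV] at this
        linear_combination this
    have : b * normV q = 0 := by
      rw [← hqlx, hb, normV, Finset.mul_sum]
      refine Finset.sum_congr rfl fun i _ => ?_
      simp
      ring
    have hb0 : b = 0 := by simpa [hQ] using this
    apply hl
    rw [hb, hb0, zero_smul]
  obtain ⟨b, hb⟩ := cross_parallel (x := conjV q) (y := l) hp hpq hpl
  have hb0 : b ≠ 0 := by
    rintro rfl
    exact hcr (by rw [hb, zero_smul])
  have hl' : l = ((∑ i, conjV l0 i * l i) / normV l0) • l0 +
      (a / normV l0) • crossV (conjV l0) q := by
    have e0 := congrFun ha 0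
    have e1 := congrFun ha 1
    have e2 := congrFun ha 2
    have hN' : normV l0 = l0 0 * conjV l0 0 + l0 1 * conjV l0 1 + l0 2 * conjV l0 2 := by
      rw [normV, Fin.sum_univ_three]
    simp only [crossV, Matrix.cons_val, Pi.smul_apply, smul_eq_mul] at e0 e1 e2
    ext i
    fin_cases i <;> simp [crossV, Fin.sum_univ_three] <;> field_simp <;> rw [hN']
    · linear_combination conjV l0 1 * e2 - conjV l0 2 * e1
    · linear_combination conjV l0 2 * e0 - conjV l0 0 * e2
    · linear_combination conjV l0 0 * e1 - conjV l0 1 * e0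
  refine ⟨b⁻¹, _, _, hl', ?_⟩
  generalize (∑ i, conjV l0 i * l i) / normV l0 = s at hl' ⊢
  generalize a / normV l0 = t at hl' ⊢
  have hpb : p = b⁻¹ • crossV (conjV q) l := by
    rw [hb, smul_smul, inv_mul_cancel₀ hb0, one_smul]
  rw [hpb]
  congr 1
  rw [Fin.sum_univ_three] at hconj
  rw [hl']
  ext i
  fin_cases i <;> simp [crossV, normV, Fin.sum_univ_three]
  · linear_combination (-t * q 0) * hconj
  · linear_combination (-t * q 1) * hconj
  · linear_combination (-t * q 2) * hconj

/-! ### Binary forms -/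

section Helpers

open MvPolynomial

/-- The exponent `(j, k)`. -/
def exp2 (j k : ℕ) : Fin 2 →₀ ℕ := Finsupp.single 0 j + Finsupp.single 1 k

lemma eq_exp2 {m : Fin 2 →₀ ℕ} {e : ℕ} (h : m.degree = e) :
    m 0 ≤ e ∧ m = exp2 (m 0) (e - m 0) := by
  rw [Finsupp.degree_eq_sum, Fin.sum_univ_two] at h
  refine ⟨by omega, ?_⟩
  ext i
  fin_cases i
  · simp [exp2]
  · simp [exp2]
    omega

lemma binary_zero {G : MvPolynomial (Fin 2) ℂ} {e : ℕ} (hG : G.IsHomogeneous e)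
    (h : ∀ j ≤ e, coeff (exp2 j (e - j)) G = 0) : G = 0 := by
  ext m
  rw [coeff_zero]
  by_cases hm : m.degree = e
  · obtain ⟨h1, h2⟩ := eq_exp2 hm
    rw [h2]
    exact h _ h1
  · exact hG.coeff_eq_zero hm

lemma binary_eval10 {G : MvPolynomial (Fin 2) ℂ} {e : ℕ} (hG : G.IsHomogeneous e) :
    eval ![1, 0] G = coeff (exp2 e 0) G := by
  rw [eval_eq', Finset.sum_eq_single (exp2 e 0)]
  · simp [exp2]
  · intro m hm hne
    have hdeg := hG.degree_eq_sum_deg_support hm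
    obtain ⟨h1, h2⟩ := eq_exp2 (m := m) (e := e) hdeg.symm
    have h3 : m 1 ≠ 0 := by
      intro h4
      apply hne
      have h5 := congrArg (fun f => f 1) h2
      simp [exp2] at h5
      rw [h2]
      congr 1 <;> omega
    simp [h3]
  · intro hm
    simp [notMem_support_iff.mp hm]

lemma binary_eval01 {G : MvPolynomial (Fin 2) ℂ} {e : ℕ} (hG : G.IsHomogeneous e) :
    eval ![0, 1] G = coeff (exp2 0 e) G := by
  rw [eval_eq', Finset.sum_eq_single (exp2 0 e)]
  · simp [exp2]
  · intro m hm hne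
    have hdeg := hG.degree_eq_sum_deg_support hm
    obtain ⟨h1, h2⟩ := eq_exp2 (m := m) (e := e) hdeg.symm
    have h3 : m 0 ≠ 0 := by
      intro h4
      apply hne
      rw [h2]
      congr 1
      omega
    simp [h3]
  · intro hm
    simp [notMem_support_iff.mp hm]

/-- The linear form `a X₀ + b X₁`. -/
def lin2 (a b : ℂ) : MvPolynomial (Fin 2) ℂ := C a * X 0 + C b * X 1

lemma lin2_hom (a b : ℂ) : (lin2 a b).IsHomogeneous 1 :=
  (isHomogeneous_C_mul_X a 0).add (isHomogeneous_C_mul_X b 1)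

/-- Restriction of sections along `(s,t) ↦ (s a + t b, s x + t y)`. -/
def restr (a b x y : Fin 3 → ℂ) :
    (Fin 3 → MvPolynomial (Fin 3) ℂ) →ₗ[ℂ] MvPolynomial (Fin 2) ℂ :=
  ∑ i : Fin 3, LinearMap.mulLeft ℂ (lin2 (a i) (b i)) ∘ₗ
    (aeval (R := ℂ) (fun j => lin2 (x j) (y j))).toLinearMap ∘ₗ LinearMap.proj i

/-- Restriction of sections along `(s,t) ↦ (c, s x + t y)`. -/
def restrConst (c x y : Fin 3 → ℂ) :
    (Fin 3 → MvPolynomial (Fin 3) ℂ) →ₗ[ℂ] MvPolynomial (Fin 2) ℂ :=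
  ∑ i : Fin 3, c i •
    ((aeval (R := ℂ) (fun j => lin2 (x j) (y j))).toLinearMap ∘ₗ LinearMap.proj i)

lemma eval_sub (x y : Fin 3 → ℂ) (s t : ℂ) (P : MvPolynomial (Fin 3) ℂ) :
    eval ![s, t] (aeval (R := ℂ) (fun j => lin2 (x j) (y j)) P) = aeval (s • x + t • y) P := by
  have : (aeval (R := ℂ) ![s, t]).comp (aeval (R := ℂ) (fun j => lin2 (x j) (y j)))
      = aeval (R := ℂ) (s • x + t • y) := by
    apply MvPolynomial.algHom_ext
    intro i
    simp [lin2]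
    ring
  rw [← this]
  simp [aeval_eq_eval]

lemma eval_restr (a b x y : Fin 3 → ℂ) (s t : ℂ) (g : Fin 3 → MvPolynomial (Fin 3) ℂ) :
    eval ![s, t] (restr a b x y g) = evalSection (s • a + t • b) (s • x + t • y) g := by
  simp only [restr, evalSection, LinearMap.sum_apply, map_sum, LinearMap.comp_apply,
    LinearMap.smul_apply, LinearMap.mulLeft_apply, map_mul, AlgHom.toLinearMap_apply, eval_sub,
    LinearMap.proj_apply]
  refine Finset.sum_congr rfl fun i _ => ?_
  simp [lin2]
  left
  ring

lemma eval_restrConst (c x y : Fin 3 → ℂ) (s t : ℂ) (g : Fin 3 → MvPolynomial (Fin 3) ℂ) :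
    eval ![s, t] (restrConst c x y g) = evalSection c (s • x + t • y) g := by
  simp only [restrConst, evalSection, LinearMap.sum_apply, map_sum, LinearMap.comp_apply,
    LinearMap.smul_apply, AlgHom.toLinearMap_apply, smul_eval, eval_sub,
    LinearMap.proj_apply, smul_eq_mul]

lemma restr_hom (a b x y : Fin 3 → ℂ) {d : ℕ} {g : Fin 3 → MvPolynomial (Fin 3) ℂ}
    (hg : ∀ i, (g i).IsHomogeneous d) : (restr a b x y g).IsHomogeneous (d + 1) := by
  simp only [restr, LinearMap.sum_apply, LinearMap.comp_apply, LinearMap.mulLeft_apply,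
    AlgHom.toLinearMap_apply, LinearMap.proj_apply]
  refine IsHomogeneous.sum _ _ _ fun i _ => ?_
  have h := (hg i).aeval (fun j => lin2 (x j) (y j)) (fun j => lin2_hom (x j) (y j))
  have h2 := (lin2_hom (a i) (b i)).mul h
  rwa [one_mul, add_comm 1 d] at h2

lemma restrConst_hom (c x y : Fin 3 → ℂ) {d : ℕ} {g : Fin 3 → MvPolynomial (Fin 3) ℂ}
    (hg : ∀ i, (g i).IsHomogeneous d) : (restrConst c x y g).IsHomogeneous d := by
  simp only [restrConst, LinearMap.sum_apply, LinearMap.comp_apply, LinearMap.smul_apply,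
    AlgHom.toLinearMap_apply, LinearMap.proj_apply]
  refine IsHomogeneous.sum _ _ _ fun i _ => ?_
  have h := (hg i).aeval (fun j => lin2 (x j) (y j)) (fun j => lin2_hom (x j) (y j))
  rw [one_mul] at h
  rw [smul_eq_C_mul]
  exact h.C_mul _

lemma evalSection_add (p p' l : Fin 3 → ℂ) (g : Fin 3 → MvPolynomial (Fin 3) ℂ) :
    evalSection (p + p') l g = evalSection p l g + evalSection p' l g := by
  simp [evalSection, add_mul, Finset.sum_add_distrib]

lemma evalSection_smul (c : ℂ) (p l : Fin 3 → ℂ) (g : Fin 3 → MvPolynomial (Fin 3) ℂ) :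
    evalSection (c • p) l g = c * evalSection p l g := by
  simp [evalSection, mul_assoc, Finset.mul_sum]

/-! ### Dimension count -/

lemma finrank_hom (d : ℕ) :
    Module.finrank ℂ (homogeneousSubmodule (Fin 3) ℂ d) = (d + 2).choose 2 := by
  rw [homogeneousSubmodule_eq_finsupp_supported]
  rw [(AddMonoidAlgebra.supportedEquivFinsupp (R := ℂ) (S := ℂ)
    {m : Fin 3 →₀ ℕ | m.degree = d}).finrank_eq]
  have e : {m : Fin 3 →₀ ℕ | m.degree = d} ≃ Sym (Fin 3) d :=
    (Equiv.subtypeEquivRight (fun m => by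
      simp [Finsupp.degree_eq_sum, Finsupp.sum_fintype])).trans
      (Sym.equivNatSum (Fin 3) d).symm
  haveI : Fintype {m : Fin 3 →₀ ℕ | m.degree = d} := Fintype.ofEquiv _ e.symm
  rw [Module.finrank_finsupp_self, Fintype.card_congr e, Sym.card_sym_eq_choose]
  simp only [Fintype.card_fin]
  rw [show 3 + d - 1 = d + 2 by omega, Nat.choose_symm_add]

lemma dim_bound (d n : ℕ) (q : Fin n → Fin 3 → ℂ) {ι : Type} [Fintype ι]
    (Φ : ι → (Fin 3 → MvPolynomial (Fin 3) ℂ) →ₗ[ℂ] ℂ)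
    (hΦ : ∀ g : Fin 3 → MvPolynomial (Fin 3) ℂ, (∀ i, (g i).IsHomogeneous d) →
      (∀ i, Φ i g = 0) → ∀ k p l, (p, l) ∈ twistorFiberV (q k) → evalSection p l g = 0) :
    3 * (d + 2).choose 2 ≤ Module.finrank ℂ (vanishingOnFibers d q) + Fintype.card ι := by
  let H := homogeneousSubmodule (Fin 3) ℂ d
  haveI : Module.Finite ℂ H := Module.Finite.of_fg (homogeneousSubmodule_fg _ _ d)
  let ψ : (Fin 3 → H) →ₗ[ℂ] (Fin 3 → MvPolynomial (Fin 3) ℂ) := H.subtype.compLeft (Fin 3)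
  have hψ : Function.Injective ψ := by
    intro a b hab
    ext1 i
    exact Subtype.ext (congrFun hab i)
  have hW : vanishingOnFibers d q ≤ LinearMap.range ψ := by
    intro g hg
    have h1 := hg.1
    rw [SetLike.mem_coe, Submodule.mem_pi] at h1
    exact ⟨fun i => ⟨g i, h1 i (Set.mem_univ i)⟩, rfl⟩
  haveI : Module.Finite ℂ (vanishingOnFibers d q) := Submodule.finiteDimensional_of_le hW
  let Ψ : (Fin 3 → H) →ₗ[ℂ] (ι → ℂ) := LinearMap.pi Φ ∘ₗ ψ
  have hker : (LinearMap.ker Ψ).map ψ ≤ vanishingOnFibers d q := by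
    rintro _ ⟨g, hg, rfl⟩
    have hhom : ∀ i, (ψ g i).IsHomogeneous d := fun i => (g i).2
    refine ⟨?_, ?_⟩
    · rw [SetLike.mem_coe, Submodule.mem_pi]
      intro i _
      exact hhom i
    · simp only [SetLike.mem_coe, Submodule.mem_iInf, LinearMap.mem_ker]
      intro k p l hpl
      refine hΦ (ψ g) hhom (fun i => ?_) k p l hpl
      exact congrFun (LinearMap.mem_ker.mp hg) i
  have h1 := Submodule.finrank_mono hker
  rw [← (Submodule.equivMapOfInjective ψ hψ (LinearMap.ker Ψ)).finrank_eq] at h1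
  have h2 := LinearMap.finrank_range_add_finrank_ker Ψ
  have h3 := Submodule.finrank_le (LinearMap.range Ψ)
  rw [Module.finrank_fintype_fun_eq_card] at h3
  have h4 : Module.finrank ℂ (Fin 3 → H) = 3 * (d + 2).choose 2 := by
    rw [Module.finrank_pi_fintype]
    simp only [H, finrank_hom, Finset.sum_const, Finset.card_univ, Fintype.card_fin, smul_eq_mul]
  rw [h4] at h2
  omega

/-- The coefficient functional. -/
def coeffL (m : Fin 2 →₀ ℕ) : MvPolynomial (Fin 2) ℂ →ₗ[ℂ] ℂ := lcoeff ℂ m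

lemma fiber_vanish {q l0 : Fin 3 → ℂ} (hq : q ≠ 0) (hl0 : l0 ≠ 0)
    (hql : ∑ i, q i * l0 i = 0) {g : Fin 3 → MvPolynomial (Fin 3) ℂ}
    (h : restr (crossV (conjV q) l0) (normV q • conjV l0) l0 (crossV (conjV l0) q) g = 0)
    {p l : Fin 3 → ℂ} (hpl : (p, l) ∈ twistorFiberV q) : evalSection p l g = 0 := by
  obtain ⟨c, s, t, rfl, rfl⟩ := fiber_param hq hl0 hql hpl
  rw [evalSection_smul, ← eval_restr, h, map_zero, mul_zero]

lemma line_vanish {l0 v w : Fin 3 → ℂ}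
    (hvw : ∀ y : Fin 3 → ℂ, ∑ i, l0 i * y i = 0 → ∃ s t : ℂ, y = s • v + t • w)
    {g : Fin 3 → MvPolynomial (Fin 3) ℂ} (h1 : evalSection v l0 g = 0)
    (h2 : evalSection w l0 g = 0) (q : Fin 3 → ℂ) : evalSection (crossV (conjV q) l0) l0 g = 0 := by
  obtain ⟨s, t, h⟩ := hvw (crossV (conjV q) l0) (by
    simp [Fin.sum_univ_three, crossV]
    ring)
  rw [h, evalSection_add, evalSection_smul, evalSection_smul, h1, h2]
  simp

lemma bound_one (n d : ℕ) (q : Fin n → Fin 3 → ℂ) (hq : ∀ k, q k ≠ 0) (l0 : Fin 3 → ℂ)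
    (hl0 : l0 ≠ 0) (hql : ∀ k, ∑ i, q k i * l0 i = 0) :
    3 * (d + 2).choose 2 ≤
      Module.finrank ℂ (vanishingOnFibers d q) + (2 + n * (d + 1)) := by
  obtain ⟨v, w, hvw⟩ := orth_span hl0
  let R : Fin n → (Fin 3 → MvPolynomial (Fin 3) ℂ) →ₗ[ℂ] MvPolynomial (Fin 2) ℂ := fun k =>
    restr (crossV (conjV (q k)) l0) (normV (q k) • conjV l0) l0 (crossV (conjV l0) (q k))
  have key := dim_bound d n q (ι := Fin 2 ⊕ (Fin n × Fin (d + 1)))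
    (Sum.elim (fun i => evalSection (![v, w] i) l0)
      (fun x => coeffL (exp2 x.2 (d + 1 - x.2)) ∘ₗ R x.1)) (by
    intro g hg h k p l hpl
    refine fiber_vanish (hq k) hl0 (hql k) ?_ hpl
    have hhom := restr_hom (crossV (conjV (q k)) l0) (normV (q k) • conjV l0) l0
      (crossV (conjV l0) (q k)) hg
    refine binary_zero hhom fun j hj => ?_
    rcases Nat.lt_or_ge j (d + 1) with hlt | hge
    · exact h (Sum.inr (k, ⟨j, hlt⟩))
    · obtain rfl : j = d + 1 := le_antisymm hj hge
      rw [Nat.sub_self, ← binary_eval10 hhom, eval_restr]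
      simpa using line_vanish hvw (h (Sum.inl 0)) (h (Sum.inl 1)) (q k))
  simpa using key

lemma bound_two (n d : ℕ) (q : Fin n → Fin 3 → ℂ) (hq : ∀ k, q k ≠ 0) (l0 : Fin 3 → ℂ)
    (hl0 : l0 ≠ 0) (hql : ∀ k, ∑ i, q k i * l0 i = 0) :
    3 * (d + 2).choose 2 ≤
      Module.finrank ℂ (vanishingOnFibers d q) + (2 + ((d + 1) + n * d)) := by
  obtain ⟨v, w, hvw⟩ := orth_span hl0
  have hc0 : conjV l0 ≠ 0 := by
    intro h
    apply normV_ne_zero hl0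
    simp [normV, h]
  obtain ⟨v', w', hvw'⟩ := orth_span hc0
  let R : Fin n → (Fin 3 → MvPolynomial (Fin 3) ℂ) →ₗ[ℂ] MvPolynomial (Fin 2) ℂ := fun k =>
    restr (crossV (conjV (q k)) l0) (normV (q k) • conjV l0) l0 (crossV (conjV l0) (q k))
  have key := dim_bound d n q (ι := Fin 2 ⊕ (Fin (d + 1) ⊕ (Fin n × Fin d)))
    (Sum.elim (fun i => evalSection (![v, w] i) l0)
      (Sum.elim (fun j => coeffL (exp2 j (d - j)) ∘ₗ restrConst (conjV l0) v' w')
        (fun x => coeffL (exp2 (x.2 + 1) (d + 1 - (x.2 + 1))) ∘ₗ R x.1))) (by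
    intro g hg h k p l hpl
    refine fiber_vanish (hq k) hl0 (hql k) ?_ hpl
    have hhom := restr_hom (crossV (conjV (q k)) l0) (normV (q k) • conjV l0) l0
      (crossV (conjV l0) (q k)) hg
    have hJ : restrConst (conjV l0) v' w' g = 0 :=
      binary_zero (restrConst_hom (conjV l0) v' w' hg) fun j hj =>
        h (Sum.inr (Sum.inl ⟨j, Nat.lt_succ_of_le hj⟩))
    refine binary_zero hhom fun j hj => ?_
    rcases Nat.lt_or_ge j (d + 1) with hlt | hge
    · rcases j with _ | j
      · rw [Nat.sub_zero, ← binary_eval01 hhom, eval_restr]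
        obtain ⟨s, t, hst⟩ := hvw' (crossV (conjV l0) (q k)) (by
          simp [Fin.sum_univ_three, crossV]
          ring)
        rw [zero_smul, zero_smul, zero_add, zero_add, one_smul, one_smul, evalSection_smul, hst,
          ← eval_restrConst, hJ, map_zero, mul_zero]
      · exact h (Sum.inr (Sum.inr (k, ⟨j, Nat.lt_of_succ_lt_succ hlt⟩)))
    · obtain rfl : j = d + 1 := le_antisymm hj hge
      rw [Nat.sub_self, ← binary_eval10 hhom, eval_restr]
      simpa using line_vanish hvw (h (Sum.inl 0)) (h (Sum.inl 1)) (q k))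
  simpa using key

end Helpers

/-- For `n ≥ 3`, `d ≥ 1` and `A` a union of `n` pairwise disjoint twistor fibers all
meeting a common bidegree `(1,0)` curve `L` (a fiber of `π₂`),
`h¹(I_A(1,d)) ≥ n − 2 + max{0, n − (d+1)}`.  Since `h¹(I_A(1,d)) = h⁰(I_A(1,d)) − χ`
with `χ(I_A(1,d)) = (d+1)(d+3) − n(d+2)`, and
`h⁰(I_A(1,d)) = dim(vanishingOnFibers) − C(d+1,2)`, this reads: the space of bidegree
`(1,d)` polynomials vanishing on `A` has dimension at least
`C(d+1,2) + (d+1)(d+3) − n(d+2) + n − 2 + max{0, n − (d+1)}`. -/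
theorem h1_lower_bound_for_collinear_twistor_fibers (n d : ℕ) (hn : 3 ≤ n) (hd : 1 ≤ d)
    (q : Fin n → Fin 3 → ℂ) (hq : ∀ k, q k ≠ 0)
    (hdisj : ∀ k l, k ≠ l → twistorFiberV (q k) ∩ twistorFiberV (q l) = ∅)
    (hcol : ∃ ℓ₀ : Fin 3 → ℂ, ℓ₀ ≠ 0 ∧ ∀ k, ∃ p, (p, ℓ₀) ∈ twistorFiberV (q k)) :
    ((d + 1).choose 2 : ℤ) + ((d + 1) * (d + 3) - n * (d + 2)) +
        ((n : ℤ) - 2 + max 0 ((n : ℤ) - (d + 1))) ≤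
      (Module.finrank ℂ (vanishingOnFibers d q) : ℤ) := by
  obtain ⟨l0, hl0, hp⟩ := hcol
  have hql : ∀ k, ∑ i, q k i * l0 i = 0 := fun k => by
    obtain ⟨p, hp'⟩ := hp k
    exact hp'.2.2.2.2
  have b1 := bound_one n d q hq l0 hl0 hql
  have b2 := bound_two n d q hq l0 hl0 hql
  have c1 : 2 * (d + 1).choose 2 = (d + 1) * d := by
    rw [Nat.choose_two_right, Nat.mul_div_cancel' (Nat.even_mul_pred_self _).two_dvd]
    rfl
  have c2 : 2 * (d + 2).choose 2 = (d + 2) * (d + 1) := by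
    rw [Nat.choose_two_right, Nat.mul_div_cancel' (Nat.even_mul_pred_self _).two_dvd]
    rfl
  zify at b1 b2 c1 c2
  rcases max_cases 0 ((n : ℤ) - (d + 1)) with ⟨h, _⟩ | ⟨h, _⟩ <;> rw [h] <;> nlinarith
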